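/- If ln 2 + 1 were a zero of some nonzero polynomial F ∈ ℚ[X,Y] evaluated as F(x, e^x), i.e. F(ln 2 + 1, 2e) = 0, then e would be algebraic over ℚ(ln 2). -/

import Mathlib

open Polynomial in
/-- Clearing denominators in the value of an integer polynomial. -/
lemma aux_integral {L : Type*} [Field L] (D : ℤ) (x : L) (hx : IsIntegral ℤ (D • x))
    (g : ℤ[X]) (e : ℕ) (he : g.natDegree ≤ e) :
    IsIntegral ℤ ((D : L) ^ e * aeval x g) := by
  rw [aeval_eq_sum_range, Finset.mul_sum]
  refine IsIntegral.sum _ fun i hi => ?_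
  have hi' : i ≤ e := by
    have := Finset.mem_range.mp hi
    omega
  have : (D : L) ^ e * (g.coeff i • x ^ i)
      = ((g.coeff i * D ^ (e - i) : ℤ) : L) * (D • x) ^ i := by
    obtain ⟨k, rfl⟩ := Nat.exists_eq_add_of_le hi'
    simp only [zsmul_eq_mul, Nat.add_sub_cancel_left, mul_pow]
    push_cast
    ring
  rw [this]
  exact (isIntegral_algebraMap (R := ℤ) (A := L)).mul (hx.pow i)

open Polynomial in
/-- A common annihilating integer polynomial with nonzero constant term. -/
lemma aux_poly {L : Type*} [Field L] [Algebra.IsAlgebraic ℤ L] (s : Finset L)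
    (hs : ∀ x ∈ s, x ≠ 0) :
    ∃ f : ℤ[X], f.eval 0 ≠ 0 ∧ ∀ x ∈ s, aeval x f = 0 := by
  have h : ∀ x : L, ∃ q : ℤ[X], x ≠ 0 → q.coeff 0 ≠ 0 ∧ aeval x q = 0 := by
    intro x
    by_cases hx : x = 0
    · exact ⟨0, fun h => (h hx).elim⟩
    · obtain ⟨q, h1, h2⟩ := (Algebra.IsAlgebraic.isAlgebraic (R := ℤ) x)
        |>.exists_nonzero_coeff_and_aeval_eq_zero (mem_nonZeroDivisors_of_ne_zero hx)
      exact ⟨q, fun _ => ⟨h1, h2⟩⟩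
  choose q hq using h
  refine ⟨∏ x ∈ s, q x, ?_, fun x hx => ?_⟩
  · rw [eval_prod]
    refine Finset.prod_ne_zero_iff.mpr fun x hx => ?_
    rw [← coeff_zero_eq_eval_zero]
    exact (hq x (hs x hx)).1
  · rw [map_prod]
    exact Finset.prod_eq_zero hx (hq x (hs x hx)).2

open Polynomial in
/-- A Galois-invariant exponential sum with nonzero constant part does not vanish. -/
lemma aux_exp_sum {L : Type*} [Field L] [Algebra ℚ L] [FiniteDimensional ℚ L] [IsGalois ℚ L]
    (φ : L →+* ℂ) {ι : Type*} [Fintype ι] [DecidableEq L] (w : ι → ℤ) (s : ι → L)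
    (hinv : ∀ σ : L ≃ₐ[ℚ] L, ∃ e : ι ≃ ι, ∀ i, s (e i) = σ (s i) ∧ w (e i) = w i)
    (hN : ∑ i with s i = 0, w i ≠ 0) :
    ∑ i, (w i : ℂ) * Complex.exp (φ (s i)) ≠ 0 := by
  intro h0
  set N := ∑ i with s i = 0, w i with hNdef
  have : CharZero L := algebraRat.charZero L
  have : Algebra.IsAlgebraic ℤ L := by
    have : Algebra.IsAlgebraic ℚ L := inferInstance
    exact (IsFractionRing.comap_isAlgebraic_iff (A := ℤ) (K := ℚ) (C := L)).mpr this
  obtain ⟨f, hf0, hf⟩ := aux_poly ((Finset.univ.filter fun i => s i ≠ 0).image s) (by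
    intro x hx
    obtain ⟨i, hi, rfl⟩ := Finset.mem_image.mp hx
    exact (Finset.mem_filter.mp hi).2)
  have hfne : f ≠ 0 := by rintro rfl; simp at hf0
  obtain ⟨D, hD0, hD⟩ := Algebra.IsAlgebraic.exists_integral_multiples ℤ (Finset.univ.image s)
  obtain ⟨c, hc⟩ := LindemannWeierstrass.exp_polynomial_approx f hf0
  set d := f.natDegree with hd
  set W : ℝ := ∑ i with s i ≠ 0, |(w i : ℝ)| with hW
  -- choose a large prime
  have hlim : Filter.Tendsto (fun p : ℕ => W * ((|D| : ℝ) ^ d * |c|) *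
      (((|D| : ℝ) ^ d * |c|) ^ (p - 1) / (p - 1).factorial)) Filter.atTop (nhds 0) := by
    have h1 := (FloorSemiring.tendsto_pow_div_factorial_atTop ((|D| : ℝ) ^ d * |c|)).comp
      (Filter.tendsto_sub_atTop_nat 1)
    simpa using h1.const_mul (W * ((|D| : ℝ) ^ d * |c|))
  obtain ⟨p0, hp0⟩ := Filter.eventually_atTop.mp (hlim.eventually_lt_const one_pos)
  obtain ⟨p, hpge, hp⟩ := Nat.exists_infinite_primes
    (p0 + (eval 0 f).natAbs + D.natAbs + N.natAbs + 1)
  have hsmall := hp0 p (by omega)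
  obtain ⟨n, hn, g, hg, happ⟩ := hc p (by omega) hp
  set T : L := ∑ i with s i ≠ 0, (w i : L) * aeval (s i) g with hT
  -- T is rational
  have hTfix : ∀ σ : L ≃ₐ[ℚ] L, σ T = T := by
    intro σ
    obtain ⟨e, he⟩ := hinv σ
    rw [hT, map_sum, Finset.sum_filter, Finset.sum_filter]
    symm
    rw [← Equiv.sum_comp e]
    refine Finset.sum_congr rfl fun i _ => ?_
    have e1 : σ (aeval (s i) g) = aeval (σ (s i)) g :=
      (aeval_algHom_apply (σ.toAlgHom.restrictScalars ℤ) (s i) g).symm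
    simp [(he i).1, (he i).2, e1]
  obtain ⟨t, ht⟩ := (IsGalois.mem_range_algebraMap_iff_fixed T).mpr hTfix
  have hint : IsIntegral ℤ ((D : L) ^ (p * d) * T) := by
    rw [hT, Finset.mul_sum]
    refine IsIntegral.sum _ fun i _ => ?_
    rw [mul_left_comm]
    refine (isIntegral_algebraMap (R := ℤ) (A := L) (x := w i)).mul ?_
    exact aux_integral D (s i) (hD _ (Finset.mem_image_of_mem _ (Finset.mem_univ i))) g _
      (by omega)
  have hint2 : IsIntegral ℤ ((D : ℚ) ^ (p * d) * t) := by
    rw [← ht] at hint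
    have : (D : L) ^ (p * d) * algebraMap ℚ L t = algebraMap ℚ L ((D : ℚ) ^ (p * d) * t) := by
      simp
    rw [this] at hint
    exact (isIntegral_algebraMap_iff (algebraMap ℚ L).injective).mp hint
  obtain ⟨m, hm⟩ := IsIntegrallyClosed.isIntegral_iff.mp hint2
  have hmL : (m : L) = (D : L) ^ (p * d) * T := by
    rw [← ht]
    have := congrArg (algebraMap ℚ L) hm
    simpa using this
  have hmC : (m : ℂ) = (D : ℂ) ^ (p * d) * φ T := by
    have := congrArg φ hmL
    simpa using this
  set M : ℤ := D ^ (p * d) * (n * N) + p * m with hM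
  have hpZ : Prime (p : ℤ) := Nat.prime_iff_prime_int.mp hp
  have hM0 : M ≠ 0 := by
    intro h
    have h1 : (p : ℤ) ∣ D ^ (p * d) * (n * N) := by
      refine ⟨-m, ?_⟩
      linarith
    have small : ∀ z : ℤ, z ≠ 0 → z.natAbs < p → ¬ (p : ℤ) ∣ z := by
      intro z hz hzp hdvd
      have := Nat.le_of_dvd (Int.natAbs_pos.mpr hz) (Int.natCast_dvd.mp hdvd)
      omega
    rcases hpZ.dvd_or_dvd h1 with h2 | h2
    · exact small D hD0 (by omega) (hpZ.dvd_of_dvd_pow h2)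
    · rcases hpZ.dvd_or_dvd h2 with h3 | h3
      · exact hn h3
      · exact small N hN (by omega) h3
  have hM1 : (1 : ℝ) ≤ ‖(M : ℂ)‖ := by
    rw [Complex.norm_intCast]
    exact_mod_cast Int.one_le_abs hM0
  -- the analytic estimate
  have hsplit : (N : ℂ) + ∑ i with s i ≠ 0, (w i : ℂ) * Complex.exp (φ (s i)) = 0 := by
    rw [← h0, ← Finset.sum_filter_add_sum_filter_not Finset.univ (fun i => s i = 0)]
    congr 1
    rw [hNdef]
    push_cast
    refine Finset.sum_congr rfl fun i hi => ?_
    simp [(Finset.mem_filter.mp hi).2]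
  have hφT : φ T = ∑ i with s i ≠ 0, (w i : ℂ) * aeval (φ (s i)) g := by
    rw [hT, map_sum]
    refine Finset.sum_congr rfl fun i _ => ?_
    have e1 : φ (aeval (s i) g) = aeval (φ (s i)) g :=
      (aeval_algHom_apply (φ.toIntAlgHom) (s i) g).symm
    simp [e1]
  have hMeq : (M : ℂ) = -((D : ℂ) ^ (p * d) * ∑ i with s i ≠ 0,
      (w i : ℂ) * (n • Complex.exp (φ (s i)) - p • aeval (φ (s i)) g)) := by
    have e1 : ∑ i with s i ≠ 0,
        (w i : ℂ) * (n • Complex.exp (φ (s i)) - p • aeval (φ (s i)) g)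
        = n * (∑ i with s i ≠ 0, (w i : ℂ) * Complex.exp (φ (s i))) - p * φ T := by
      rw [hφT, Finset.mul_sum, Finset.mul_sum, ← Finset.sum_sub_distrib]
      refine Finset.sum_congr rfl fun i _ => ?_
      simp only [zsmul_eq_mul, nsmul_eq_mul]
      ring
    rw [e1, hM]
    push_cast
    rw [hmC, eq_neg_of_add_eq_zero_right hsplit]
    ring
  have hbound : ‖(M : ℂ)‖ ≤ (|D| : ℝ) ^ (p * d) * (W * (|c| ^ p / (p - 1).factorial)) := by
    rw [hMeq, norm_neg, norm_mul, norm_pow, Complex.norm_intCast]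
    gcongr
    rw [hW, Finset.sum_mul]
    refine (norm_sum_le _ _).trans (Finset.sum_le_sum fun i hi => ?_)
    rw [norm_mul, Complex.norm_intCast]
    gcongr
    refine (happ (r := φ (s i)) ?_).trans ?_
    · rw [mem_aroots]
      refine ⟨hfne, ?_⟩
      have e1 : φ (aeval (s i) f) = aeval (φ (s i)) f :=
        (aeval_algHom_apply (φ.toIntAlgHom) (s i) f).symm
      rw [← e1, hf _ (Finset.mem_image_of_mem _ hi), map_zero]
    · refine div_le_div_of_nonneg_right ?_ (Nat.cast_nonneg _)
      rw [← abs_pow]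
      exact le_abs_self _
  have hfin : (|D| : ℝ) ^ (p * d) * (W * (|c| ^ p / (p - 1).factorial))
      = W * ((|D| : ℝ) ^ d * |c|) *
      (((|D| : ℝ) ^ d * |c|) ^ (p - 1) / (p - 1).factorial) := by
    obtain ⟨k, rfl⟩ := Nat.exists_eq_add_of_le' hp.one_le
    simp only [Nat.add_sub_cancel]
    rw [mul_comm (k + 1) d, pow_mul]
    ring
  linarith

/-- Lindemann's theorem for `log 2`. -/
lemma aux_transcendental_log_two : Transcendental ℚ (Real.log 2) := by
  classical
  intro halg
  have hC : IsAlgebraic ℚ ((Real.log 2 : ℝ) : ℂ) := halg.algebraMap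
  set a : ℂ := ((Real.log 2 : ℝ) : ℂ) with ha
  have hexp : Complex.exp a = 2 := by
    rw [ha, ← Complex.ofReal_exp, Real.exp_log (by norm_num)]
    norm_num
  set q := minpoly ℚ a with hq
  have hqne : q ≠ 0 := minpoly.ne_zero hC.isIntegral
  let L := IntermediateField.adjoin ℚ (q.rootSet ℂ)
  have hsf : q.IsSplittingField ℚ L :=
    IntermediateField.adjoin_rootSet_isSplittingField (IsAlgClosed.splits _)
  have hfd : FiniteDimensional ℚ L := Polynomial.IsSplittingField.finiteDimensional L q
  have hgal : IsGalois ℚ L :=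
    IsGalois.of_separable_splitting_field (p := q) (minpoly.irreducible hC.isIntegral).separable
  have haL : a ∈ L := IntermediateField.subset_adjoin _ _
    ((Polynomial.mem_rootSet).mpr ⟨hqne, minpoly.aeval ℚ a⟩)
  let α : L := ⟨a, haL⟩
  let φ : L →+* ℂ := algebraMap L ℂ
  have hφα : φ α = a := rfl
  refine aux_exp_sum (L := L) φ (ι := Finset (L ≃ₐ[ℚ] L)) (fun S => (-2) ^ S.card)
    (fun S => ∑ σ ∈ S, -(σ α)) ?_ ?_ ?_
  · intro τ
    refine ⟨(Equiv.mulLeft τ).finsetCongr, fun S => ⟨?_, ?_⟩⟩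
    · simp [Equiv.finsetCongr_apply, Finset.sum_map, map_sum]
    · simp [Equiv.finsetCongr_apply]
  · intro h
    have hmem : (∅ : Finset (L ≃ₐ[ℚ] L)) ∈
        Finset.univ.filter (fun S : Finset (L ≃ₐ[ℚ] L) => ∑ σ ∈ S, -(σ α) = 0) := by simp
    rw [← Finset.add_sum_erase _ _ hmem] at h
    have hdvd : (2 : ℤ) ∣ ∑ S ∈ (Finset.univ.filter
        (fun S : Finset (L ≃ₐ[ℚ] L) => ∑ σ ∈ S, -(σ α) = 0)).erase ∅, (-2) ^ S.card := by
      refine Finset.dvd_sum fun S hS => ?_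
      have hne : S ≠ ∅ := (Finset.mem_erase.mp hS).1
      exact (show (2 : ℤ) ∣ -2 by norm_num).trans
        (dvd_pow_self _ (Finset.card_ne_zero.mpr (Finset.nonempty_iff_ne_empty.mpr hne)))
    simp only [Finset.card_empty, pow_zero] at h
    omega
  · have hprod : ∏ σ : L ≃ₐ[ℚ] L, (1 + (-2) * Complex.exp (-(φ (σ α)))) = 0 := by
      refine Finset.prod_eq_zero (Finset.mem_univ 1) ?_
      rw [AlgEquiv.one_apply, hφα, Complex.exp_neg, hexp]
      norm_num
    rw [Finset.prod_one_add, Finset.powerset_univ] at hprod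
    rw [← hprod]
    refine Finset.sum_congr rfl fun S _ => ?_
    rw [Finset.prod_mul_distrib, Finset.prod_const, map_sum, Complex.exp_sum]
    simp

theorem exp_algebraic_of_relation (F : MvPolynomial (Fin 2) ℚ) (hF : F ≠ 0)
    (hval : MvPolynomial.aeval ![Real.log 2 + 1, 2 * Real.exp 1] F = 0) :
    IsAlgebraic (IntermediateField.adjoin ℚ ({Real.log 2} : Set ℝ)) (Real.exp 1) := by
  by_contra hcon
  set K := IntermediateField.adjoin ℚ ({Real.log 2} : Set ℝ) with hK
  have hlog : Real.log 2 ∈ K := IntermediateField.subset_adjoin _ _ rfl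
  have hx : Transcendental ℚ (Real.log 2 + 1) := by
    intro h
    have := h.sub (isAlgebraic_one (R := ℚ) (A := ℝ))
    rw [add_sub_cancel_right] at this
    exact aux_transcendental_log_two this
  have hind1 : AlgebraicIndependent ℚ (fun _ : Fin 1 => Real.log 2 + 1) :=
    algebraicIndependent_unique_type_iff.mpr hx
  have hle : Algebra.adjoin ℚ (Set.range (fun _ : Fin 1 => Real.log 2 + 1))
      ≤ K.toSubalgebra := by
    rw [Algebra.adjoin_le_iff]
    rintro _ ⟨_, rfl⟩
    exact K.add_mem hlog K.one_mem
  have htr : Transcendental (Algebra.adjoin ℚ (Set.range (fun _ : Fin 1 => Real.log 2 + 1)))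
      (2 * Real.exp 1) := by
    rintro ⟨P, hP0, hP⟩
    apply hcon
    have h2 : IsAlgebraic K (2 * Real.exp 1) := by
      refine ⟨P.map (Subalgebra.inclusion hle).toRingHom, ?_, ?_⟩
      · exact (Polynomial.map_ne_zero_iff (Subalgebra.inclusion_injective hle)).mpr hP0
      · rw [Polynomial.aeval_def, Polynomial.eval₂_map]
        exact hP
    have h3 : IsAlgebraic K ((1 / 2 : ℝ)) := by
      have : (1 / 2 : ℝ) = algebraMap K ℝ (1 / 2) := by
        simp only [map_div₀, map_one]
        rw [map_ofNat]
      rw [this]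
      exact isAlgebraic_algebraMap _
    have h4 := h3.mul h2
    rwa [show (1 / 2 : ℝ) * (2 * Real.exp 1) = Real.exp 1 by ring] at h4
  have hind2 := (hind1.option_iff_transcendental (2 * Real.exp 1)).mpr htr
  have hind3 := hind2.comp (![some 0, none] : Fin 2 → Option (Fin 1)) (by
    intro i j h
    fin_cases i <;> fin_cases j <;> simp_all)
  have hfun : (fun o : Option (Fin 1) => o.elim (2 * Real.exp 1) (fun _ => Real.log 2 + 1)) ∘
      (![some 0, none] : Fin 2 → Option (Fin 1)) = ![Real.log 2 + 1, 2 * Real.exp 1] := by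
    ext i
    fin_cases i <;> simp
  rw [hfun] at hind3
  exact hF (hind3.eq_zero_of_aeval_eq_zero F hval)
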